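/- Let 1 ≤ p ≠ q < ∞ and let T ∈ B(ℓᵖ), S ∈ B(ℓ^q). If T or S is compact, then T and S are not equivalent after extension. -/

import Mathlib

open ContinuousLinearMap
open scoped ENNReal

/-- The coordinate truncation `x ↦ 1_s x` on `ℓᵖ`. -/
noncomputable def lpTrunc (p : ℝ≥0∞) [Fact (1 ≤ p)] (s : Finset ℕ) :
    lp (fun _ : ℕ => ℂ) p →L[ℂ] lp (fun _ : ℕ => ℂ) p :=
  ∑ i ∈ s, lp.singleContinuousLinearMap ℂ (fun _ : ℕ => ℂ) p i ∘L lp.evalCLM ℂ (fun _ : ℕ => ℂ) p i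

section Truncation

variable {p : ℝ≥0∞} [Fact (1 ≤ p)]

lemma lpTrunc_eq_sum (s : Finset ℕ) (x : lp (fun _ : ℕ => ℂ) p) :
    lpTrunc p s x = ∑ i ∈ s, lp.single p i (x i) := by
  simp [lpTrunc, lp.evalCLM]

lemma lpTrunc_apply_of_mem {s : Finset ℕ} {i : ℕ} (hi : i ∈ s) (x : lp (fun _ : ℕ => ℂ) p) :
    lpTrunc p s x i = x i := by
  rw [lpTrunc_eq_sum, lp.coeFn_sum, Finset.sum_apply]
  simp [hi]

lemma lpTrunc_apply_of_notMem {s : Finset ℕ} {i : ℕ} (hi : i ∉ s)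
    (x : lp (fun _ : ℕ => ℂ) p) : lpTrunc p s x i = 0 := by
  rw [lpTrunc_eq_sum, lp.coeFn_sum, Finset.sum_apply]
  simp [hi]

lemma isCompactOperator_lpTrunc (s : Finset ℕ) : IsCompactOperator (lpTrunc p s) := by
  have : lpTrunc p s ∈ compactOperator (RingHom.id ℂ) (lp (fun _ : ℕ => ℂ) p)
      (lp (fun _ : ℕ => ℂ) p) :=
    Submodule.sum_mem _ fun i _ =>
      (isCompactOperator_of_locallyCompactSpace_dom
        (lp.evalCLM ℂ (fun _ : ℕ => ℂ) p i)).clm_comp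
        (lp.singleContinuousLinearMap ℂ (fun _ : ℕ => ℂ) p i)
  exact this

lemma lp_toReal_pos (hp : p ≠ ⊤) : 0 < p.toReal :=
  ENNReal.toReal_pos (zero_lt_one.trans_le Fact.out).ne' hp

lemma lp_norm_add_rpow_of_disjoint (hp : p ≠ ⊤) {s : Finset ℕ} {u w : lp (fun _ : ℕ => ℂ) p}
    (hu : ∀ i ∉ s, u i = 0) (hw : ∀ i ∈ s, w i = 0) :
    ‖u + w‖ ^ p.toReal = ‖u‖ ^ p.toReal + ‖w‖ ^ p.toReal := by
  have hp0 := lp_toReal_pos hp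
  rw [lp.norm_rpow_eq_tsum hp0, lp.norm_rpow_eq_tsum hp0, lp.norm_rpow_eq_tsum hp0,
    ← ((lp.memℓp u).summable hp0).tsum_add ((lp.memℓp w).summable hp0)]
  refine tsum_congr fun i => ?_
  by_cases hi : i ∈ s
  · simp [hw i hi, Real.zero_rpow hp0.ne']
  · simp [hu i hi, Real.zero_rpow hp0.ne']

lemma sub_lpTrunc_apply_of_mem {s : Finset ℕ} (x : lp (fun _ : ℕ => ℂ) p) :
    ∀ i ∈ s, (x - lpTrunc p s x) i = 0 := fun i hi => by
  simp [lpTrunc_apply_of_mem hi]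

lemma norm_rpow_lpTrunc_add (hp : p ≠ ⊤) (s : Finset ℕ) (x : lp (fun _ : ℕ => ℂ) p) :
    ‖lpTrunc p s x‖ ^ p.toReal + ‖x - lpTrunc p s x‖ ^ p.toReal = ‖x‖ ^ p.toReal := by
  rw [← lp_norm_add_rpow_of_disjoint hp (fun i hi => lpTrunc_apply_of_notMem hi x)
    (sub_lpTrunc_apply_of_mem x), add_sub_cancel]

lemma norm_lpTrunc_le (hp : p ≠ ⊤) (s : Finset ℕ) (x : lp (fun _ : ℕ => ℂ) p) :
    ‖lpTrunc p s x‖ ≤ ‖x‖ := by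
  rw [← Real.rpow_le_rpow_iff (norm_nonneg _) (norm_nonneg _) (lp_toReal_pos hp),
    ← norm_rpow_lpTrunc_add hp s x]
  exact le_add_of_nonneg_right (by positivity)

lemma norm_sub_lpTrunc_le (hp : p ≠ ⊤) (s : Finset ℕ) (x : lp (fun _ : ℕ => ℂ) p) :
    ‖x - lpTrunc p s x‖ ≤ ‖x‖ := by
  rw [← Real.rpow_le_rpow_iff (norm_nonneg _) (norm_nonneg _) (lp_toReal_pos hp),
    ← norm_rpow_lpTrunc_add hp s x]
  exact le_add_of_nonneg_left (by positivity)

lemma tendsto_lpTrunc (hp : p ≠ ⊤) (x : lp (fun _ : ℕ => ℂ) p) :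
    Filter.Tendsto (fun s => lpTrunc p s x) Filter.atTop (nhds x) := by
  simp only [lpTrunc_eq_sum]
  exact lp.hasSum_single hp x

lemma norm_lpTrunc_le_sum (s : Finset ℕ) (x : lp (fun _ : ℕ => ℂ) p) :
    ‖lpTrunc p s x‖ ≤ ∑ i ∈ s, ‖x i‖ := by
  rw [lpTrunc_eq_sum]
  refine (norm_sum_le _ _).trans (Finset.sum_le_sum fun i _ => ?_)
  rw [lp.norm_single (zero_lt_one.trans_le Fact.out)]

lemma not_isCompactOperator_id_lp :
    ¬ IsCompactOperator (ContinuousLinearMap.id ℂ (lp (fun _ : ℕ => ℂ) p)) := by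
  intro h
  have : FiniteDimensional ℂ (lp (fun _ : ℕ => ℂ) p) := .of_isCompactOperator_id h
  have hli : LinearIndependent ℂ (fun i : ℕ => (lp.single p i (1 : ℂ) : lp (fun _ : ℕ => ℂ) p)) := by
    rw [linearIndependent_iff']
    intro s g hg i hi
    have h2 := congrArg (fun x : lp (fun _ : ℕ => ℂ) p => x i) hg
    simp only [lp.coeFn_sum, Finset.sum_apply, lp.coeFn_smul, Pi.smul_apply, lp.coeFn_single] at h2
    simpa [Pi.single_apply, hi] using h2
  have := hli.finite_of_isNoetherian
  exact not_finite ℕ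

end Truncation

lemma exists_norm_add_mul_eq (y z : ℂ) : ∃ c : ℂ, ‖c‖ = 1 ∧ ‖y + c * z‖ = ‖y‖ + ‖z‖ := by
  rcases eq_or_ne z 0 with rfl | hz
  · exact ⟨1, by simp⟩
  rcases eq_or_ne y 0 with rfl | hy
  · exact ⟨1, by simp⟩
  have hy' : (‖y‖ : ℂ) ≠ 0 := by simpa using hy
  have hz' : (‖z‖ : ℂ) ≠ 0 := by simpa using hz
  refine ⟨y / ‖y‖ * (‖z‖ / z), by simp [hy, hz], ?_⟩
  have h : y + y / ‖y‖ * (‖z‖ / z) * z = y / ‖y‖ * ((‖y‖ + ‖z‖ : ℝ) : ℂ) := by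
    push_cast
    field_simp
  rw [h, norm_mul, Complex.norm_real, Real.norm_of_nonneg (by positivity)]
  simp [hy]

/-- If `T` satisfies asymptotically a lower `q`-estimate on
vectors supported far out, where `q < p`, then the norms of the tails of `T` tend to zero. -/
lemma exists_finset_norm_le_of_lower_estimate {p : ℝ≥0∞} [Fact (1 ≤ p)] (hp : p ≠ ⊤)
    {Z : Type*} [NormedAddCommGroup Z] [NormedSpace ℂ Z] {q : ℝ} (hq : 1 ≤ q)
    (hqp : q < p.toReal) (T : lp (fun _ : ℕ => ℂ) p →L[ℂ] Z)
    (H : ∀ x, ∀ η > 0, ∃ s : Finset ℕ, ∀ w, ‖w‖ ≤ 1 → (∀ i ∈ s, w i = 0) →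
      ∃ c : ℂ, ‖c‖ = 1 ∧ ∃ a b : ℝ, 0 ≤ a ∧ 0 ≤ b ∧ ‖T x‖ - η ≤ a ∧ ‖T w‖ - η ≤ b ∧
        a ^ q + b ^ q ≤ (‖T (x + c • w)‖ + η) ^ q)
    {δ : ℝ} (hδ : 0 < δ) :
    ∃ s : Finset ℕ, ∀ w, ‖w‖ ≤ 1 → (∀ i ∈ s, w i = 0) → ‖T w‖ ≤ δ := by
  by_contra! hcon
  have hp0 := lp_toReal_pos hp
  have hq0 : 0 < q := by linarith
  have key : ∀ t : ℝ, 0 < t → t ≤ 1 → ∀ η : ℝ, 0 < η → 2 * η < ‖T‖ → η < t * δ →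
      (‖T‖ - 2 * η) ^ q + (t * δ - η) ^ q ≤
        (‖T‖ * (1 + t ^ p.toReal) ^ (p.toReal)⁻¹ + η) ^ q := by
    intro t ht ht1 η hη hη1 hη2
    obtain ⟨x₀, hx₀, hTx₀⟩ := T.exists_lt_apply_of_lt_opNorm (r := ‖T‖ - η) (by linarith)
    have hev : ∀ᶠ s in Filter.atTop, ‖T‖ - η < ‖T (lpTrunc p s x₀)‖ :=
      (((T.continuous.tendsto _).comp (tendsto_lpTrunc hp x₀)).norm).eventually_const_lt hTx₀
    obtain ⟨s₀, hs₀⟩ := hev.exists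
    obtain ⟨s₁, hs₁⟩ := H (lpTrunc p s₀ x₀) η hη
    obtain ⟨w, hw1, hw, hTw⟩ := hcon (s₀ ∪ s₁)
    have htw : ‖(t : ℂ) • w‖ ≤ t := by
      rw [norm_smul, Complex.norm_real, Real.norm_of_nonneg ht.le]
      nlinarith
    obtain ⟨c, hc, a, b, ha, hb, hxa, hwb, hab⟩ := hs₁ ((t : ℂ) • w) (htw.trans ht1)
      (fun i hi => by
        rw [lp.coeFn_smul, Pi.smul_apply, hw i (Finset.mem_union_right _ hi), smul_zero])
    have hbt : t * δ - η ≤ b := by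
      rw [map_smul, norm_smul, Complex.norm_real, Real.norm_of_nonneg ht.le] at hwb
      nlinarith
    have hnorm : ‖lpTrunc p s₀ x₀ + c • (t : ℂ) • w‖ ≤ (1 + t ^ p.toReal) ^ (p.toReal)⁻¹ := by
      rw [Real.le_rpow_inv_iff_of_pos (norm_nonneg _) (by positivity) hp0,
        lp_norm_add_rpow_of_disjoint hp (s := s₀) (fun i hi => lpTrunc_apply_of_notMem hi x₀)
        (fun i hi => by
          rw [lp.coeFn_smul, Pi.smul_apply, lp.coeFn_smul, Pi.smul_apply,
            hw i (Finset.mem_union_left _ hi), smul_zero, smul_zero])]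
      gcongr
      · exact Real.rpow_le_one (norm_nonneg _) ((norm_lpTrunc_le hp _ _).trans hx₀.le) hp0.le
      · rw [norm_smul, hc, one_mul]; exact htw
    calc _ ≤ a ^ q + b ^ q := by
          gcongr
          linarith
      _ ≤ _ := hab
      _ ≤ _ := by
          gcongr
          exact (T.le_opNorm _).trans (by gcongr)
  have hT : 0 < ‖T‖ := by
    obtain ⟨w, hw1, -, hTw⟩ := hcon ∅
    nlinarith [T.le_opNorm w, norm_nonneg T, norm_nonneg w]
  have lim : ∀ t : ℝ, 0 < t → t ≤ 1 → δ ^ q ≤ ‖T‖ ^ q * t ^ (p.toReal - q) := by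
    intro t ht ht1
    have h1 : ‖T‖ ^ q + (t * δ) ^ q ≤ (‖T‖ * (1 + t ^ p.toReal) ^ (p.toReal)⁻¹) ^ q := by
      have hl : Filter.Tendsto (fun η : ℝ => (‖T‖ - 2 * η) ^ q + (t * δ - η) ^ q)
          (nhdsWithin 0 (Set.Ioi 0)) (nhds (‖T‖ ^ q + (t * δ) ^ q)) := by
        have : Continuous (fun η : ℝ => (‖T‖ - 2 * η) ^ q + (t * δ - η) ^ q) :=
          ((Real.continuous_rpow_const hq0.le).comp (by fun_prop)).add
            ((Real.continuous_rpow_const hq0.le).comp (by fun_prop))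
        simpa using (this.tendsto 0).mono_left nhdsWithin_le_nhds
      have hr : Filter.Tendsto
          (fun η : ℝ => (‖T‖ * (1 + t ^ p.toReal) ^ (p.toReal)⁻¹ + η) ^ q)
          (nhdsWithin 0 (Set.Ioi 0))
          (nhds ((‖T‖ * (1 + t ^ p.toReal) ^ (p.toReal)⁻¹) ^ q)) := by
        have : Continuous (fun η : ℝ => (‖T‖ * (1 + t ^ p.toReal) ^ (p.toReal)⁻¹ + η) ^ q) :=
          (Real.continuous_rpow_const hq0.le).comp (by fun_prop)
        simpa using (this.tendsto 0).mono_left nhdsWithin_le_nhds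
      refine le_of_tendsto_of_tendsto hl hr ?_
      have hm : 0 < min (‖T‖ / 2) (t * δ) := by positivity
      filter_upwards [Ioo_mem_nhdsGT hm] with η hη
      have h1 := hη.2.trans_le (min_le_left _ _)
      exact key t ht ht1 η hη.1 (by linarith) (hη.2.trans_le (min_le_right _ _))
    have h2 : ((1 + t ^ p.toReal) ^ (p.toReal)⁻¹) ^ q ≤ 1 + t ^ p.toReal := by
      rw [← Real.rpow_mul (by positivity)]
      have : 0 ≤ t ^ p.toReal := by positivity
      refine Real.rpow_le_self_of_one_le (by linarith) ?_
      rw [inv_mul_le_one₀ hp0]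
      exact hqp.le
    rw [Real.mul_rpow ht.le hδ.le, Real.mul_rpow hT.le (by positivity)] at h1
    have h3 : t ^ q * δ ^ q ≤ ‖T‖ ^ q * t ^ p.toReal := by
      nlinarith [mul_le_mul_of_nonneg_left h2 (by positivity : 0 ≤ ‖T‖ ^ q)]
    rw [Real.rpow_sub ht, ← mul_div_assoc, le_div_iff₀ (by positivity), mul_comm]
    exact h3
  have h0 : δ ^ q ≤ 0 := by
    have hl : Filter.Tendsto (fun t : ℝ => ‖T‖ ^ q * t ^ (p.toReal - q))
        (nhdsWithin 0 (Set.Ioi 0)) (nhds 0) := by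
      have : Continuous (fun t : ℝ => ‖T‖ ^ q * t ^ (p.toReal - q)) :=
        continuous_const.mul (Real.continuous_rpow_const (by linarith))
      have h := (this.tendsto 0).mono_left (nhdsWithin_le_nhds (s := Set.Ioi 0))
      rwa [Real.zero_rpow (by linarith), mul_zero] at h
    refine ge_of_tendsto hl ?_
    filter_upwards [Ioo_mem_nhdsGT zero_lt_one] with t ht
    exact lim t ht.1 ht.2.le
  exact absurd h0 (not_le.2 (by positivity))

lemma exists_finset_norm_functional_le {p : ℝ≥0∞} [Fact (1 ≤ p)] (hp : p ≠ ⊤)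
    (hp1 : 1 < p.toReal) (f : lp (fun _ : ℕ => ℂ) p →L[ℂ] ℂ) {δ : ℝ} (hδ : 0 < δ) :
    ∃ s : Finset ℕ, ∀ w, ‖w‖ ≤ 1 → (∀ i ∈ s, w i = 0) → ‖f w‖ ≤ δ := by
  refine exists_finset_norm_le_of_lower_estimate hp le_rfl hp1 f (fun x η hη => ?_) hδ
  refine ⟨∅, fun w _ _ => ?_⟩
  obtain ⟨c, hc, h⟩ := exists_norm_add_mul_eq (f x) (f w)
  refine ⟨c, hc, ‖f x‖, ‖f w‖, norm_nonneg _, norm_nonneg _, by linarith, by linarith, ?_⟩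
  simp only [Real.rpow_one, map_add, map_smul, smul_eq_mul, h]
  linarith

lemma exists_finset_norm_lpTrunc_le {p q : ℝ≥0∞} [Fact (1 ≤ p)] [Fact (1 ≤ q)] (hp : p ≠ ⊤)
    (hp1 : 1 < p.toReal) (T : lp (fun _ : ℕ => ℂ) p →L[ℂ] lp (fun _ : ℕ => ℂ) q)
    (r : Finset ℕ) {δ : ℝ} (hδ : 0 < δ) :
    ∃ s : Finset ℕ, ∀ w, ‖w‖ ≤ 1 → (∀ i ∈ s, w i = 0) → ‖lpTrunc q r (T w)‖ ≤ δ := by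
  have hε : 0 < δ / (r.card + 1) := by positivity
  choose s hs using fun i : ℕ => exists_finset_norm_functional_le hp hp1
    (lp.evalCLM ℂ (fun _ : ℕ => ℂ) q i ∘L T) hε
  refine ⟨r.biUnion s, fun w hw1 hw => ?_⟩
  refine (norm_lpTrunc_le_sum r (T w)).trans ?_
  calc ∑ i ∈ r, ‖T w i‖ ≤ ∑ i ∈ r, δ / (r.card + 1) := Finset.sum_le_sum fun i hi =>
        hs i w hw1 fun j hj => hw j (Finset.mem_biUnion.2 ⟨i, hi, hj⟩)
    _ = r.card * (δ / (r.card + 1)) := by simp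
    _ ≤ δ := by
      rw [← mul_div_assoc, div_le_iff₀ (by positivity)]
      nlinarith

/-- Pitt's theorem. -/
theorem isCompactOperator_lp_of_lt {p q : ℝ≥0∞} [Fact (1 ≤ p)] [Fact (1 ≤ q)] (hp : p ≠ ⊤)
    (hqp : q < p) (T : lp (fun _ : ℕ => ℂ) p →L[ℂ] lp (fun _ : ℕ => ℂ) q) :
    IsCompactOperator T := by
  have hq : q ≠ ⊤ := (hqp.trans_le le_top).ne
  have hq1 : 1 ≤ q.toReal := by
    simpa using ENNReal.toReal_mono hq (Fact.out : 1 ≤ q)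
  have hqp' : q.toReal < p.toReal := (ENNReal.toReal_lt_toReal hq hp).2 hqp
  have htail : ∀ δ > 0, ∃ s : Finset ℕ, ∀ w, ‖w‖ ≤ 1 → (∀ i ∈ s, w i = 0) → ‖T w‖ ≤ δ := by
    intro δ hδ
    refine exists_finset_norm_le_of_lower_estimate hp hq1 hqp' T (fun x η hη => ?_) hδ
    have hev : ∀ᶠ r in Filter.atTop, ‖T x - lpTrunc q r (T x)‖ < η / 2 := by
      have := ((tendsto_const_nhds (x := T x)).sub (tendsto_lpTrunc hq (T x))).norm
      rw [sub_self, norm_zero] at this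
      exact this.eventually_lt_const (by positivity)
    obtain ⟨r, hr⟩ := hev.exists
    obtain ⟨s, hs⟩ := exists_finset_norm_lpTrunc_le hp (by linarith) T r (half_pos hη)
    refine ⟨s, fun w hw1 hw => ⟨1, norm_one, ‖lpTrunc q r (T x)‖, ‖T w - lpTrunc q r (T w)‖,
      norm_nonneg _, norm_nonneg _, ?_, ?_, ?_⟩⟩
    · linarith [norm_sub_norm_le (T x) (lpTrunc q r (T x))]
    · linarith [norm_sub_norm_le (T w) (T w - lpTrunc q r (T w)),
        congrArg norm (sub_sub_cancel (T w) (lpTrunc q r (T w))), hs w hw1 hw]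
    · rw [← lp_norm_add_rpow_of_disjoint hq (fun i hi => lpTrunc_apply_of_notMem hi (T x))
        (sub_lpTrunc_apply_of_mem (T w)), one_smul, map_add]
      refine Real.rpow_le_rpow (norm_nonneg _) ?_ (by linarith)
      have : lpTrunc q r (T x) + (T w - lpTrunc q r (T w)) =
          (T x + T w) - (T x - lpTrunc q r (T x)) - lpTrunc q r (T w) := by abel
      rw [this]
      linarith [norm_sub_le ((T x + T w) - (T x - lpTrunc q r (T x))) (lpTrunc q r (T w)),
        norm_sub_le (T x + T w) (T x - lpTrunc q r (T x)), hs w hw1 hw]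
  have hmem : T ∈ closure {S : lp (fun _ : ℕ => ℂ) p →L[ℂ] lp (fun _ : ℕ => ℂ) q |
      IsCompactOperator S} := by
    refine Metric.mem_closure_iff.2 fun ε hε => ?_
    obtain ⟨s, hs⟩ := htail (ε / 2) (half_pos hε)
    refine ⟨T ∘L lpTrunc p s, (isCompactOperator_lpTrunc s).clm_comp T, ?_⟩
    rw [dist_eq_norm]
    refine lt_of_le_of_lt (ContinuousLinearMap.opNorm_le_of_unit_norm (𝕜 := ℂ) (half_pos hε).le
      fun x hx => ?_) (half_lt_self hε)
    rw [sub_apply, ContinuousLinearMap.comp_apply, ← map_sub]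
    exact hs _ ((norm_sub_lpTrunc_le hp s x).trans hx.le) (sub_lpTrunc_apply_of_mem x)
  exact isClosed_setOfPred_isCompactOperator.closure_subset hmem

section EquivalenceAfterExtension

variable {X Y : Type*} [NormedAddCommGroup X] [NormedSpace ℂ X] [NormedAddCommGroup Y]
  [NormedSpace ℂ Y] {T : X →L[ℂ] X} {S : Y →L[ℂ] Y} {E : (Y × X) ≃L[ℂ] (X × Y)}
  {F : (X × Y) ≃L[ℂ] (Y × X)}

lemma isCompactOperator_id_of_eae_of_right
    (hXY : ∀ A : X →L[ℂ] Y, IsCompactOperator A)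
    (h : T.prodMap (ContinuousLinearMap.id ℂ Y) = (E : (Y × X) →L[ℂ] (X × Y)) ∘L
      (S.prodMap (ContinuousLinearMap.id ℂ X)) ∘L (F : (X × Y) →L[ℂ] (Y × X)))
    (hS : IsCompactOperator S) : IsCompactOperator (ContinuousLinearMap.id ℂ Y) := by
  let E' : (Y × X) →L[ℂ] (X × Y) := E
  let F' : (X × Y) →L[ℂ] (Y × X) := F
  let E₂₁ : Y →L[ℂ] Y := .snd ℂ X Y ∘L E' ∘L .inl ℂ Y X
  let E₂₂ : X →L[ℂ] Y := .snd ℂ X Y ∘L E' ∘L .inr ℂ Y X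
  let F₁₂ : Y →L[ℂ] Y := .fst ℂ Y X ∘L F' ∘L .inr ℂ X Y
  let F₂₂ : Y →L[ℂ] X := .snd ℂ Y X ∘L F' ∘L .inr ℂ X Y
  have hid : ContinuousLinearMap.id ℂ Y = E₂₁ ∘L S ∘L F₁₂ + E₂₂ ∘L F₂₂ := by
    ext y
    have h1 : y = (E (S (F (0, y)).1, (F (0, y)).2)).2 :=
      congrArg Prod.snd (DFunLike.congr_fun h (0, y))
    have h2 : (S (F (0, y)).1, (F (0, y)).2) = (S (F (0, y)).1, 0) + (0, (F (0, y)).2) := by simp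
    rw [h2, map_add] at h1
    exact h1
  rw [hid]
  exact ((hS.comp_clm F₁₂).clm_comp E₂₁).add ((hXY E₂₂).comp_clm F₂₂)

lemma isCompactOperator_id_of_eae_of_left
    (hXY : ∀ A : X →L[ℂ] Y, IsCompactOperator A)
    (h : T.prodMap (ContinuousLinearMap.id ℂ Y) = (E : (Y × X) →L[ℂ] (X × Y)) ∘L
      (S.prodMap (ContinuousLinearMap.id ℂ X)) ∘L (F : (X × Y) →L[ℂ] (Y × X)))
    (hT : IsCompactOperator T) : IsCompactOperator (ContinuousLinearMap.id ℂ X) := by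
  let E' : (Y × X) →L[ℂ] (X × Y) := E
  let F' : (X × Y) →L[ℂ] (Y × X) := F
  let G' : (X × Y) →L[ℂ] (Y × X) := E.symm
  let H' : (Y × X) →L[ℂ] (X × Y) := F.symm
  let E₁₁ : Y →L[ℂ] X := .fst ℂ X Y ∘L E' ∘L .inl ℂ Y X
  let E₂₂ : X →L[ℂ] Y := .snd ℂ X Y ∘L E' ∘L .inr ℂ Y X
  let F₁₁ : X →L[ℂ] Y := .fst ℂ Y X ∘L F' ∘L .inl ℂ X Y
  let F₂₁ : X →L[ℂ] X := .snd ℂ Y X ∘L F' ∘L .inl ℂ X Y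
  let G₂₁ : X →L[ℂ] X := .snd ℂ Y X ∘L G' ∘L .inl ℂ X Y
  let G₂₂ : Y →L[ℂ] X := .snd ℂ Y X ∘L G' ∘L .inr ℂ X Y
  let H₁₁ : Y →L[ℂ] X := .fst ℂ X Y ∘L H' ∘L .inl ℂ Y X
  let H₁₂ : X →L[ℂ] X := .fst ℂ X Y ∘L H' ∘L .inr ℂ Y X
  have hF₂₁ : F₂₁ = G₂₁ ∘L (T - E₁₁ ∘L S ∘L F₁₁) + G₂₂ ∘L E₂₂ ∘L F₂₁ := by
    ext x
    have h1 : T x = (E (S (F (x, 0)).1, (F (x, 0)).2)).1 :=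
      congrArg Prod.fst (DFunLike.congr_fun h (x, 0))
    have h2 : (S (F (x, 0)).1, (F (x, 0)).2) = (S (F (x, 0)).1, 0) + (0, (F (x, 0)).2) := by simp
    rw [h2, map_add] at h1
    have h3 : (E (0, (F (x, 0)).2)).1 = T x - (E (S (F (x, 0)).1, 0)).1 :=
      eq_sub_of_add_eq' h1.symm
    have h4 : E (0, (F (x, 0)).2) =
        (T x - (E (S (F (x, 0)).1, 0)).1, 0) + (0, (E (0, (F (x, 0)).2)).2) := by
      rw [← h3]; simp
    have h5 := congrArg Prod.snd (congrArg E.symm h4)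
    rw [E.symm_apply_apply, map_add] at h5
    exact h5
  have hid : ContinuousLinearMap.id ℂ X = H₁₁ ∘L F₁₁ + H₁₂ ∘L F₂₁ := by
    ext x
    have h1 : F (x, 0) = ((F (x, 0)).1, 0) + (0, (F (x, 0)).2) := by simp
    have h2 := congrArg Prod.fst (congrArg F.symm h1)
    rw [F.symm_apply_apply, map_add] at h2
    exact h2
  have hcF : IsCompactOperator F₂₁ := by
    rw [hF₂₁]
    exact ((hT.sub ((hXY F₁₁).clm_comp (E₁₁ ∘L S))).clm_comp G₂₁).add
      (((hXY E₂₂).comp_clm F₂₁).clm_comp G₂₂)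
  rw [hid]
  exact ((hXY F₁₁).clm_comp H₁₁).add (hcF.clm_comp H₁₂)

lemma eae_symm
    (h : T.prodMap (ContinuousLinearMap.id ℂ Y) = (E : (Y × X) →L[ℂ] (X × Y)) ∘L
      (S.prodMap (ContinuousLinearMap.id ℂ X)) ∘L (F : (X × Y) →L[ℂ] (Y × X))) :
    S.prodMap (ContinuousLinearMap.id ℂ X) = (E.symm : (X × Y) →L[ℂ] (Y × X)) ∘L
      (T.prodMap (ContinuousLinearMap.id ℂ Y)) ∘L (F.symm : (Y × X) →L[ℂ] (X × Y)) := by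
  rw [h]
  ext z <;> simp

end EquivalenceAfterExtension

/-- For `1 ≤ p ≠ q < ∞`, if `T ∈ B(ℓᵖ)` or `S ∈ B(ℓ^q)` is compact, then
`T` and `S` are not equivalent after extension. -/
theorem no_eae_with_compact_between_different_lp
    (p q : ℝ≥0∞) [Fact (1 ≤ p)] [Fact (1 ≤ q)] (hp : p < ⊤) (hq : q < ⊤) (hpq : p ≠ q)
    (T : lp (fun _ : ℕ => ℂ) p →L[ℂ] lp (fun _ : ℕ => ℂ) p)
    (S : lp (fun _ : ℕ => ℂ) q →L[ℂ] lp (fun _ : ℕ => ℂ) q)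
    (hc : IsCompactOperator T ∨ IsCompactOperator S) :
    ¬ ∃ (E : (lp (fun _ : ℕ => ℂ) q × lp (fun _ : ℕ => ℂ) p) ≃L[ℂ]
          (lp (fun _ : ℕ => ℂ) p × lp (fun _ : ℕ => ℂ) q))
      (F : (lp (fun _ : ℕ => ℂ) p × lp (fun _ : ℕ => ℂ) q) ≃L[ℂ]
          (lp (fun _ : ℕ => ℂ) q × lp (fun _ : ℕ => ℂ) p)),
      T.prodMap (ContinuousLinearMap.id ℂ (lp (fun _ : ℕ => ℂ) q)) =
        (E : (lp (fun _ : ℕ => ℂ) q × lp (fun _ : ℕ => ℂ) p) →L[ℂ]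
          (lp (fun _ : ℕ => ℂ) p × lp (fun _ : ℕ => ℂ) q)) ∘L
          (S.prodMap (ContinuousLinearMap.id ℂ (lp (fun _ : ℕ => ℂ) p))) ∘L
            (F : (lp (fun _ : ℕ => ℂ) p × lp (fun _ : ℕ => ℂ) q) →L[ℂ]
              (lp (fun _ : ℕ => ℂ) q × lp (fun _ : ℕ => ℂ) p)) := by
  rintro ⟨E, F, h⟩
  rcases hpq.lt_or_gt with hlt | hlt
  · have hYX := fun A => isCompactOperator_lp_of_lt hq.ne hlt A
    rcases hc with hT | hS
    · exact not_isCompactOperator_id_lp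
        (isCompactOperator_id_of_eae_of_right hYX (eae_symm h) hT)
    · exact not_isCompactOperator_id_lp
        (isCompactOperator_id_of_eae_of_left hYX (eae_symm h) hS)
  · have hXY := fun A => isCompactOperator_lp_of_lt hp.ne hlt A
    rcases hc with hT | hS
    · exact not_isCompactOperator_id_lp (isCompactOperator_id_of_eae_of_left hXY h hT)
    · exact not_isCompactOperator_id_lp (isCompactOperator_id_of_eae_of_right hXY h hS)
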